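/- arXiv:1711.09864 — 2 statements merged into one kernel-verified Lean document; each statement's English description precedes it below -/
import Mathlib

section
/- Let 0 < c_0 < 1, let b : ℝ² → ℂ be a smooth function with compact support contained in (-1/2, 1/2)², and fix nonnegative constants C, C_0, C_1, C_2. Then there is a constant C' > 0, depending only on c_0, b, C, C_0, C_1, C_2, such that the following holds for every real λ ≥ 2, every real ν with 0 ≤ ν ≤ c_0·λ, every sign σ ∈ {+1, -1}, and every smooth function a : (0, ∞) → ℂ satisfying |a^{(j)}(r)| ≤ C_j · r^{-j-1/2} for all r ≥ λ^{-1} and j ∈ {0, 1, 2}, and |a(r)| ≤ C · λ^{1/2} for all 0 < r ≤ λ^{-1}: one has λ^{1/2} · |∬_{ℝ²} b(t,s) · e^{iσ(λ|t-s| + ν(s-t))} · a(|t-s|) dt ds| ≤ C'. -/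
open Real MeasureTheory Set

lemma core_bound (B δ C C0 C1 lam μ : ℝ) (f f' a a' : ℝ → ℂ) (hB : 0 ≤ B) (hδ : 0 < δ)
    (hC0 : 0 ≤ C0) (hC1 : 0 ≤ C1) (hC : 0 ≤ C) (hlam : 2 ≤ lam) (hμ : δ * lam ≤ |μ|)
    (hf : ∀ r, HasDerivAt f (f' r) r) (hfc : Continuous f')
    (hfB : ∀ r, ‖f r‖ ≤ B) (hfB' : ∀ r, ‖f' r‖ ≤ B) (hf1 : ∀ r, 1 ≤ r → f r = 0)
    (ha : ∀ r, 0 < r → HasDerivAt a (a' r) r) (hac : ContinuousOn a' (Ioi 0))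
    (h0 : ∀ r, lam⁻¹ ≤ r → ‖a r‖ ≤ C0 * r ^ (-(1 / 2) : ℝ))
    (h1 : ∀ r, lam⁻¹ ≤ r → ‖a' r‖ ≤ C1 * r ^ (-(3 / 2) : ℝ))
    (hs : ∀ r, 0 < r → r ≤ lam⁻¹ → ‖a r‖ ≤ C * lam ^ ((1 : ℝ) / 2)) :
    ‖∫ r in Ioi (0 : ℝ), f r * Complex.exp (Complex.I * μ * r) * a r‖ ≤
      B * (C + (C0 + 2 * (C0 + C1)) / δ) * (lam ^ ((1 : ℝ) / 2) / lam) := by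
  have hl0 : 0 < lam := by linarith
  have hli : 0 < lam⁻¹ := by positivity
  have hli1 : lam⁻¹ ≤ 1 := inv_le_one_of_one_le₀ (by linarith)
  have hL : 0 < lam ^ ((1 : ℝ) / 2) := by positivity
  have hμ0 : 0 < |μ| := lt_of_lt_of_le (by positivity) hμ
  have hμn : μ ≠ 0 := abs_pos.mp hμ0
  have hμc : (μ : ℂ) ≠ 0 := by exact_mod_cast hμn
  have hIμ : Complex.I * (μ : ℂ) ≠ 0 := mul_ne_zero Complex.I_ne_zero hμc
  have hE : ∀ r : ℝ, ‖Complex.exp (Complex.I * μ * r)‖ = 1 := by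
    intro r
    have : Complex.I * μ * r = ((μ * r : ℝ) : ℂ) * Complex.I := by push_cast; ring
    rw [this, Complex.norm_exp_ofReal_mul_I]
  have hpow : (lam⁻¹) ^ (-(1 / 2) : ℝ) = lam ^ ((1 : ℝ) / 2) := by
    rw [Real.inv_rpow hl0.le, Real.rpow_neg hl0.le, inv_inv]
  set g : ℝ → ℂ := fun r => f r * Complex.exp (Complex.I * μ * r) * a r with hg
  by_cases hint : IntegrableOn g (Ioi 0)
  swap
  · rw [integral_undef hint, norm_zero]; positivity
  have hsplit : ∫ r in Ioi (0 : ℝ), g r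
      = (∫ r in Ioc 0 lam⁻¹, g r) + ∫ r in Ioc lam⁻¹ 1, g r := by
    rw [← Ioc_union_Ioi_eq_Ioi hli.le, setIntegral_union (Ioc_disjoint_Ioi le_rfl) measurableSet_Ioi
      (hint.mono_set Ioc_subset_Ioi_self) (hint.mono_set (Ioi_subset_Ioi hli.le))]
    congr 1
    refine setIntegral_eq_of_subset_of_forall_sdiff_eq_zero measurableSet_Ioi
      Ioc_subset_Ioi_self ?_
    rintro r ⟨hr1, hr2⟩
    have : 1 ≤ r := by
      by_contra h
      exact hr2 ⟨hr1, by linarith⟩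
    simp [hg, hf1 r this]
  have hfirst : ‖∫ r in Ioc 0 lam⁻¹, g r‖ ≤ B * C * (lam ^ ((1 : ℝ) / 2) / lam) := by
    have := norm_setIntegral_le_of_norm_le_const (μ := volume) (s := Ioc 0 lam⁻¹) (f := g)
      (C := B * (C * lam ^ ((1 : ℝ) / 2))) (by simp) (by
        intro r hr
        simp only [hg, norm_mul, hE, mul_one]
        exact mul_le_mul (hfB r) (hs r hr.1 hr.2) (norm_nonneg _) hB)
    rw [Measure.real, Real.volume_Ioc, ENNReal.toReal_ofReal (by linarith)] at this
    refine this.trans (le_of_eq ?_)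
    field_simp
    ring
  have hu : ∀ r ∈ uIcc lam⁻¹ 1, HasDerivAt (fun r => f r * a r) (f' r * a r + f r * a' r) r := by
    intro r hr
    rw [uIcc_of_le hli1] at hr
    exact (hf r).mul (ha r (by linarith [hr.1]))
  have hv : ∀ r ∈ uIcc lam⁻¹ 1, HasDerivAt
      (fun r : ℝ => Complex.exp (Complex.I * μ * r) / (Complex.I * μ))
      (Complex.exp (Complex.I * μ * r)) r := by
    intro r _
    have h1 : HasDerivAt (fun r : ℝ => Complex.I * μ * (r : ℂ)) (Complex.I * μ * 1) r :=
      (Complex.ofRealCLM.hasDerivAt (x := r)).const_mul (Complex.I * (μ : ℂ))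
    have h2 := (h1.cexp).div_const (Complex.I * (μ : ℂ))
    rw [mul_one, mul_div_assoc, div_self hIμ, mul_one] at h2
    exact h2
  have hIcc : Icc lam⁻¹ 1 ⊆ Ioi (0 : ℝ) := fun r hr => lt_of_lt_of_le hli hr.1
  have hca : ContinuousOn a (Ioi 0) := fun r hr => (ha r hr).continuousAt.continuousWithinAt
  have hcf : Continuous f := continuous_iff_continuousAt.mpr fun r => (hf r).continuousAt
  have hu' : IntervalIntegrable (fun r => f' r * a r + f r * a' r) volume lam⁻¹ 1 := by
    apply ContinuousOn.intervalIntegrable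
    rw [uIcc_of_le hli1]
    exact (hfc.continuousOn.mul (hca.mono hIcc)).add (hcf.continuousOn.mul (hac.mono hIcc))
  have hv' : IntervalIntegrable (fun r : ℝ => Complex.exp (Complex.I * μ * r)) volume lam⁻¹ 1 := by
    apply Continuous.intervalIntegrable
    fun_prop
  have hibp := intervalIntegral.integral_mul_deriv_eq_deriv_mul hu hv hu' hv'
  have hsecond_eq : ∫ r in Ioc lam⁻¹ 1, g r
      = ∫ r in lam⁻¹..1, (f r * a r) * Complex.exp (Complex.I * μ * r) := by
    rw [intervalIntegral.integral_of_le hli1]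
    refine integral_congr_ae (Filter.Eventually.of_forall fun r => ?_)
    simp only [hg]; ring
  have hvn : ∀ r : ℝ, ‖Complex.exp (Complex.I * μ * r) / (Complex.I * μ)‖ = |μ|⁻¹ := by
    intro r
    rw [norm_div, hE, norm_mul, Complex.norm_I, one_mul, Complex.norm_real, Real.norm_eq_abs,
      one_div]
  have hrest : ‖∫ r in lam⁻¹..1, (f' r * a r + f r * a' r) *
      (Complex.exp (Complex.I * μ * r) / (Complex.I * μ))‖ ≤
      B * (C0 + C1) * |μ|⁻¹ * (2 * lam ^ ((1 : ℝ) / 2)) := by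
    have hnot : (0 : ℝ) ∉ uIcc lam⁻¹ 1 := by
      rw [uIcc_of_le hli1]; intro h; linarith [h.1]
    have hi : IntervalIntegrable (fun r : ℝ => B * (C0 + C1) * |μ|⁻¹ * r ^ (-(3 / 2) : ℝ))
        volume lam⁻¹ 1 :=
      (intervalIntegral.intervalIntegrable_rpow (Or.inr hnot)).const_mul _
    refine (intervalIntegral.norm_integral_le_of_norm_le hli1 ?_ hi).trans ?_
    · refine Filter.Eventually.of_forall fun r hr => ?_
      have hr0 : 0 < r := hli.trans hr.1
      rw [norm_mul, hvn]
      have hp : r ^ (-(1 / 2) : ℝ) ≤ r ^ (-(3 / 2) : ℝ) :=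
        Real.rpow_le_rpow_of_exponent_ge hr0 hr.2 (by norm_num)
      have e1 : ‖f' r * a r‖ ≤ B * (C0 * r ^ (-(3 / 2) : ℝ)) := by
        rw [norm_mul]
        exact mul_le_mul (hfB' r) ((h0 r hr.1.le).trans (by gcongr)) (norm_nonneg _) hB
      have e2 : ‖f r * a' r‖ ≤ B * (C1 * r ^ (-(3 / 2) : ℝ)) := by
        rw [norm_mul]
        exact mul_le_mul (hfB r) (h1 r hr.1.le) (norm_nonneg _) hB
      have e3 := (norm_add_le (f' r * a r) (f r * a' r)).trans (add_le_add e1 e2)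
      calc _ ≤ (B * (C0 * r ^ (-(3 / 2) : ℝ)) + B * (C1 * r ^ (-(3 / 2) : ℝ))) * |μ|⁻¹ := by
            gcongr
        _ = _ := by ring
    · rw [intervalIntegral.integral_const_mul, integral_rpow (Or.inr ⟨by norm_num, hnot⟩)]
      have : (-(3 / 2) + 1 : ℝ) = -(1 / 2) := by norm_num
      rw [this, hpow, Real.one_rpow]
      gcongr
      linarith
  have hbd : ‖f lam⁻¹ * a lam⁻¹‖ ≤ B * (C0 * lam ^ ((1 : ℝ) / 2)) := by
    rw [norm_mul]
    refine mul_le_mul (hfB _) ?_ (norm_nonneg _) hB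
    rw [← hpow]; exact h0 _ le_rfl
  have hsecond : ‖∫ r in Ioc lam⁻¹ 1, g r‖ ≤
      B * (C0 + 2 * (C0 + C1)) * lam ^ ((1 : ℝ) / 2) * |μ|⁻¹ := by
    rw [hsecond_eq, hibp, hf1 1 le_rfl]
    simp only [zero_mul, zero_sub]
    refine (norm_sub_le _ _).trans ?_
    rw [norm_neg, norm_mul, hvn]
    calc _ ≤ B * (C0 * lam ^ ((1 : ℝ) / 2)) * |μ|⁻¹
          + B * (C0 + C1) * |μ|⁻¹ * (2 * lam ^ ((1 : ℝ) / 2)) := by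
          gcongr
      _ = _ := by ring
  rw [hsplit]
  refine (norm_add_le _ _).trans ((add_le_add hfirst hsecond).trans ?_)
  have hinv : |μ|⁻¹ ≤ (δ * lam)⁻¹ := inv_anti₀ (by positivity) hμ
  calc _ ≤ B * C * (lam ^ ((1 : ℝ) / 2) / lam)
        + B * (C0 + 2 * (C0 + C1)) * lam ^ ((1 : ℝ) / 2) * (δ * lam)⁻¹ := by gcongr
    _ = _ := by field_simp

/-- The "local" part of the reproducing kernel contributes `O(λ^{-1/2})` to the generalized
period integral: for `0 ≤ ν ≤ c₀λ` with `c₀ < 1` and an amplitude `a` satisfying the symbol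
bounds \eqref{2.9}, \eqref{2.10}, one has
`λ^{1/2} |∬ b(t,s) e^{±i(λ|t-s| + ν(s-t))} a(|t-s|) dt ds| ≤ C'`. -/
theorem local_term_bound
    (c₀ : ℝ) (hc₀0 : 0 < c₀) (hc₀1 : c₀ < 1)
    (b : ℝ × ℝ → ℂ) (hb : ContDiff ℝ (⊤ : ℕ∞) b) (hbsupp : HasCompactSupport b)
    (hbsub : tsupport b ⊆ Ioo (-(1 / 2) : ℝ) (1 / 2) ×ˢ Ioo (-(1 / 2) : ℝ) (1 / 2))
    (C : ℝ) (hC : 0 ≤ C) (Cc : ℕ → ℝ) (hCc : ∀ j ≤ 2, 0 ≤ Cc j) :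
    ∃ C' > (0 : ℝ), ∀ (lam : ℝ), 2 ≤ lam → ∀ (ν : ℝ), 0 ≤ ν → ν ≤ c₀ * lam →
      ∀ (σ : ℝ), (σ = 1 ∨ σ = -1) →
      ∀ (a : ℝ → ℂ), ContDiffOn ℝ (⊤ : ℕ∞) a (Ioi 0) →
      (∀ r : ℝ, lam⁻¹ ≤ r → ∀ j ≤ 2,
        ‖iteratedDerivWithin j a (Ioi 0) r‖ ≤ Cc j * r ^ (-(j : ℝ) - 1 / 2)) →
      (∀ r : ℝ, 0 < r → r ≤ lam⁻¹ → ‖a r‖ ≤ C * lam ^ ((1 : ℝ) / 2)) →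
      lam ^ ((1 : ℝ) / 2) *
        ‖∫ p : ℝ × ℝ, if p.1 = p.2 then 0 else
            b p * Complex.exp (Complex.I * σ *
              ((lam * |p.1 - p.2| + ν * (p.2 - p.1) : ℝ) : ℂ)) * a |p.1 - p.2|‖ ≤ C' := by
  obtain ⟨B1, hB1⟩ := hbsupp.exists_bound_of_continuous hb.continuous
  obtain ⟨B2, hB2⟩ := (hbsupp.fderiv (𝕜 := ℝ)).exists_bound_of_continuous
    (hb.continuous_fderiv (by simp))
  have hB1' : 0 ≤ B1 := (norm_nonneg _).trans (hB1 0)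
  have hB2' : 0 ≤ B2 := (norm_nonneg _).trans (hB2 0)
  set B := B1 + B2 with hBdef
  have hB : 0 ≤ B := by positivity
  have h0 := hCc 0 (by norm_num)
  have h1 := hCc 1 (by norm_num)
  set δ := 1 - c₀ with hδdef
  have hδ : 0 < δ := by linarith
  set K := B * (C + (Cc 0 + 2 * (Cc 0 + Cc 1)) / δ) with hK
  have hK0 : 0 ≤ K := by positivity
  refine ⟨2 * K + 1, by positivity, ?_⟩
  intro lam hlam ν hν0 hν σ hσ a ha hsym hsmall
  have hl0 : 0 < lam := by linarith
  have hsq : lam ^ ((1 : ℝ) / 2) * lam ^ ((1 : ℝ) / 2) = lam := by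
    rw [← Real.rpow_add hl0]; norm_num
  have hσa : |σ| = 1 := by rcases hσ with h | h <;> simp [h]
  have hout : ∀ t s : ℝ, ¬ (t ∈ Ioo (-(1 / 2) : ℝ) (1 / 2) ∧ s ∈ Ioo (-(1 / 2) : ℝ) (1 / 2)) →
      b (t, s) = 0 := by
    intro t s h
    by_contra hne
    exact h (hbsub (subset_tsupport b hne))
  have hda : ∀ r, 0 < r → HasDerivAt a (derivWithin a (Ioi 0) r) r := by
    intro r hr
    have : DifferentiableWithinAt ℝ a (Ioi 0) r := ha.differentiableOn (by simp) r hr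
    exact this.hasDerivWithinAt.hasDerivAt (Ioi_mem_nhds hr)
  have hca : ContinuousOn (derivWithin a (Ioi 0)) (Ioi 0) :=
    ha.continuousOn_derivWithin (uniqueDiffOn_Ioi 0) (by simp)
  have hs0 : ∀ r, lam⁻¹ ≤ r → ‖a r‖ ≤ Cc 0 * r ^ (-(1 / 2) : ℝ) := by
    intro r hr
    have := hsym r hr 0 (by norm_num)
    rw [iteratedDerivWithin_zero] at this
    convert this using 3
    norm_num
  have hs1 : ∀ r, lam⁻¹ ≤ r → ‖derivWithin a (Ioi 0) r‖ ≤ Cc 1 * r ^ (-(3 / 2) : ℝ) := by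
    intro r hr
    have := hsym r hr 1 (by norm_num)
    rw [iteratedDerivWithin_one] at this
    convert this using 3
    norm_num
  have hbd : ∀ p, HasFDerivAt b (fderiv ℝ b p) p := fun p =>
    (hb.differentiable (by simp) p).hasFDerivAt
  -- half-line bound
  have half : ∀ (s ε : ℝ), (ε = 1 ∨ ε = -1) → ∀ μ : ℝ, δ * lam ≤ |μ| →
      ‖∫ r in Ioi (0 : ℝ), b (s + ε * r, s) * Complex.exp (Complex.I * μ * r) * a r‖ ≤
        K * (lam ^ ((1 : ℝ) / 2) / lam) := by
    intro s ε hε μ hμ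
    refine core_bound B δ C (Cc 0) (Cc 1) lam μ (fun r => b (s + ε * r, s))
      (fun r => fderiv ℝ b (s + ε * r, s) (ε, 0)) a (derivWithin a (Ioi 0)) hB hδ h0 h1 hC hlam hμ
      ?_ ?_ ?_ ?_ ?_ hda hca hs0 hs1 hsmall
    · intro r
      have hp : HasDerivAt (fun r : ℝ => (s + ε * r, s)) (ε, (0 : ℝ)) r := by
        have h := ((hasDerivAt_id r).const_mul ε).const_add s
        rw [mul_one] at h
        exact h.prodMk (hasDerivAt_const r s)
      exact (hbd (s + ε * r, s)).comp_hasDerivAt r hp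
    · have := hb.continuous_fderiv (by simp)
      fun_prop
    · intro r
      exact (hB1 _).trans (by linarith)
    · intro r
      have hn : ‖((ε, 0) : ℝ × ℝ)‖ ≤ 1 := by
        rcases hε with h | h <;> simp [h, Prod.norm_def]
      calc _ ≤ ‖fderiv ℝ b (s + ε * r, s)‖ * ‖((ε, 0) : ℝ × ℝ)‖ :=
            ContinuousLinearMap.le_opNorm _ _
        _ ≤ B2 * 1 := by gcongr; exact hB2 _
        _ ≤ B := by linarith
    · intro r hr
      apply hout
      rintro ⟨⟨q1, q2⟩, ⟨q3, q4⟩⟩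
      rcases hε with h | h <;> subst h <;> linarith
  set F : ℝ × ℝ → ℂ := fun p => if p.1 = p.2 then 0 else
            b p * Complex.exp (Complex.I * σ *
              ((lam * |p.1 - p.2| + ν * (p.2 - p.1) : ℝ) : ℂ)) * a |p.1 - p.2| with hF
  set M := lam ^ ((1 : ℝ) / 2) / lam with hM
  have hM0 : 0 ≤ M := by positivity
  have inner : ∀ s : ℝ, ‖∫ t, F (t, s)‖ ≤ 2 * (K * M) := by
    intro s
    have htr : ∫ t, F (t, s) = ∫ r, F (r + s, s) :=
      (integral_add_right_eq_self (fun t => F (t, s)) s).symm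
    rw [htr]
    by_cases hint : Integrable (fun r => F (r + s, s))
    swap
    · rw [integral_undef hint, norm_zero]; positivity
    rw [← intervalIntegral.integral_Iic_add_Ioi (b := 0) hint.integrableOn hint.integrableOn]
    have e1 : ∫ r in Ioi (0 : ℝ), F (r + s, s) = ∫ r in Ioi (0 : ℝ),
        b (s + 1 * r, s) * Complex.exp (Complex.I * (σ * (lam - ν) : ℝ) * r) * a r := by
      refine setIntegral_congr_fun measurableSet_Ioi fun r hr => ?_
      have hr' : (0 : ℝ) < r := hr
      have hne : ¬ (r + s = s) := by intro h; linarith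
      simp only [hF, hne, if_false, add_sub_cancel_right, abs_of_pos hr']
      rw [one_mul, add_comm s r]
      congr 3
      push_cast; ring
    have e2 : ∫ r in Iic (0 : ℝ), F (r + s, s) = ∫ r in Ioi (0 : ℝ),
        b (s + (-1) * r, s) * Complex.exp (Complex.I * (σ * (lam + ν) : ℝ) * r) * a r := by
      have h := integral_comp_neg_Ioi (0 : ℝ) (fun r => F (r + s, s))
      rw [neg_zero] at h
      rw [← h]
      refine setIntegral_congr_fun measurableSet_Ioi fun r hr => ?_
      have hr' : (0 : ℝ) < r := hr
      have hne : ¬ (-r + s = s) := by intro h; linarith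
      simp only [hF, hne, if_false, add_sub_cancel_right, abs_neg, abs_of_pos hr']
      have : s + (-1) * r = -r + s := by ring
      rw [this]
      congr 3
      push_cast; ring
    rw [e1, e2, two_mul]
    refine (norm_add_le _ _).trans (add_le_add (half s (-1) (Or.inr rfl) _ ?_)
      (half s 1 (Or.inl rfl) _ ?_))
    · rw [abs_mul, hσa, one_mul, hδdef]
      exact le_trans (by nlinarith) (le_abs_self _)
    · rw [abs_mul, hσa, one_mul, hδdef]
      exact le_trans (by nlinarith) (le_abs_self _)
  have main : ‖∫ p, F p‖ ≤ 2 * (K * M) := by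
    by_cases hint : Integrable F
    swap
    · rw [integral_undef hint, norm_zero]; positivity
    have hfub : ∫ p, F p = ∫ s, ∫ t, F (t, s) := integral_prod_symm F hint
    have hres : ∫ s, ∫ t, F (t, s)
        = ∫ s in Ioo (-(1 / 2) : ℝ) (1 / 2), ∫ t, F (t, s) := by
      symm
      refine setIntegral_eq_integral_of_forall_compl_eq_zero fun s hs => ?_
      have : ∀ t, F (t, s) = 0 := by
        intro t
        simp [hF, hout t s (fun h => hs h.2)]
      simp [this]
    rw [hfub, hres]
    have := norm_setIntegral_le_of_norm_le_const (μ := volume)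
      (s := Ioo (-(1 / 2) : ℝ) (1 / 2)) (f := fun s => ∫ t, F (t, s))
      (C := 2 * (K * M)) (by simp) (fun s _ => inner s)
    rw [Measure.real, Real.volume_Ioo, ENNReal.toReal_ofReal (by norm_num)] at this
    refine this.trans (le_of_eq ?_)
    ring
  calc lam ^ ((1 : ℝ) / 2) * ‖∫ p, F p‖ ≤ lam ^ ((1 : ℝ) / 2) * (2 * (K * M)) := by gcongr
    _ = 2 * K * ((lam ^ ((1 : ℝ) / 2) * lam ^ ((1 : ℝ) / 2)) / lam) := by rw [hM]; ring
    _ = 2 * K := by rw [hsq, div_self hl0.ne', mul_one]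
    _ ≤ 2 * K + 1 := by linarith
end

section
/- Let ε₀ ∈ (0, 1/10), set N = ⌈16/ε₀⌉, and fix nonnegative constants C_0, C_1, …, C_N. There is a constant C > 0, depending only on ε₀ and C_0, …, C_N, such that the following holds for every real λ ≥ 2. Suppose φ : ℝ² → ℝ and a : ℝ² → ℂ are smooth, the support of a is contained in an axis-parallel closed square Q ⊆ (-1/2, 1/2)² of side length at most 8·λ^{-ε₀}, and for every (t,s) ∈ Q: |∂_t^j a(t,s)| ≤ C_j · λ^{j/2} for all 0 ≤ j ≤ N; |∂_t^j(∂_t φ)(t,s)| ≤ λ^{ε₀/8} for all 0 ≤ j ≤ N; and |∂_t² φ(t,s)| ≥ λ^{-ε₀/8}. Then λ^{1/2} · |∬_{ℝ²} a(t,s) · e^{iλφ(t,s)} dt ds| ≤ C · λ^{-ε₀/2}. -/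
open Real MeasureTheory Set

/-- The mixed partial derivative `∂_t^{α₁} ∂_s^{α₂} f` of a function `f : ℝ² → E`,
evaluated at `p = (t, s)`. -/
noncomputable def pderiv2 {E : Type*} [NormedAddCommGroup E] [NormedSpace ℝ E]
    (α : ℕ × ℕ) (f : ℝ × ℝ → E) (p : ℝ × ℝ) : E :=
  iteratedDeriv α.1 (fun t => iteratedDeriv α.2 (fun s => f (t, s)) p.2) p.1


lemma osc_right (A A' : ℝ → ℂ) (ψ ψ' ψ'' : ℝ → ℝ) (lam m M D C0 t0 δ β : ℝ)
    (hlam : 0 < lam) (hm : 0 < m) (hδ : 0 < δ) (hβ : t0 + δ ≤ β) (hβ1 : β - t0 ≤ 1)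
    (hM : 0 ≤ M) (hD : 0 ≤ D) (hC0 : 0 ≤ C0)
    (hA : ∀ t, HasDerivAt A (A' t) t) (hψ : ∀ t, HasDerivAt ψ (ψ' t) t)
    (hψ' : ∀ t, HasDerivAt ψ' (ψ'' t) t)
    (bA : ∀ t ∈ Icc (t0 + δ) β, ‖A t‖ ≤ C0) (bA' : ∀ t ∈ Icc (t0 + δ) β, ‖A' t‖ ≤ D)
    (bψ'' : ∀ t ∈ Icc (t0 + δ) β, |ψ'' t| ≤ M)
    (bψ' : ∀ t ∈ Icc (t0 + δ) β, m * |t - t0| ≤ |ψ' t|) :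
    ‖∫ t in (t0 + δ)..β, A t * Complex.exp (Complex.I * ((lam * ψ t : ℝ) : ℂ))‖ ≤
      2 * (C0 / (lam * m * δ)) + D / (lam * m) * (-log δ) + C0 * M / (lam * m ^ 2) * (1 / δ) := by
  set E : ℝ → ℂ := fun t => Complex.exp (Complex.I * ((lam * ψ t : ℝ) : ℂ)) with hE
  have nE : ∀ t, ‖E t‖ = 1 := by
    intro t
    simp only [hE]
    rw [mul_comm]
    exact Complex.norm_exp_ofReal_mul_I _
  have dE : ∀ t, HasDerivAt E (E t * (Complex.I * (lam * ψ' t : ℝ))) t := by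
    intro t
    have h1 : HasDerivAt (fun t => ((lam * ψ t : ℝ) : ℂ)) ((lam * ψ' t : ℝ) : ℂ) t :=
      ((hψ t).const_mul lam).ofReal_comp
    exact (h1.const_mul Complex.I).cexp
  have cAE : Continuous (fun t => A t * E t) := by
    have h1 : Continuous A := continuous_iff_continuousAt.2 fun t => (hA t).continuousAt
    have h2 : Continuous E := continuous_iff_continuousAt.2 fun t => (dE t).continuousAt
    exact h1.mul h2
  set G : ℝ → ℂ := fun t => A t * E t * (Complex.I * (lam * ψ' t : ℝ))⁻¹ with hG
  have upos : ∀ t ∈ Icc (t0 + δ) β, 0 < t - t0 := fun t ht => by linarith [ht.1]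
  have lowψ : ∀ t ∈ Icc (t0 + δ) β, m * (t - t0) ≤ |ψ' t| := by
    intro t ht
    have := bψ' t ht
    rwa [abs_of_pos (upos t ht)] at this
  have posψ : ∀ t ∈ Icc (t0 + δ) β, 0 < |ψ' t| := fun t ht =>
    lt_of_lt_of_le (mul_pos hm (upos t ht)) (lowψ t ht)
  have nI : ∀ t, ‖(Complex.I * (lam * ψ' t : ℝ))⁻¹‖ = (lam * |ψ' t|)⁻¹ := by
    intro t
    rw [norm_inv, norm_mul, Complex.norm_I, one_mul, Complex.norm_real, Real.norm_eq_abs, abs_mul,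
      abs_of_pos hlam]
  have nG : ∀ t ∈ Icc (t0 + δ) β, ‖G t‖ ≤ C0 / (lam * m * δ) := by
    intro t ht
    simp only [hG]
    rw [norm_mul, norm_mul, nE, mul_one, nI, div_eq_mul_inv]
    have h1 : lam * m * δ ≤ lam * |ψ' t| := by
      rw [mul_assoc]
      refine mul_le_mul_of_nonneg_left (le_trans ?_ (lowψ t ht)) hlam.le
      exact mul_le_mul_of_nonneg_left (by linarith [ht.1]) hm.le
    have h2 : (lam * |ψ' t|)⁻¹ ≤ (lam * m * δ)⁻¹ := inv_anti₀ (by positivity) h1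
    exact mul_le_mul (bA t ht) h2 (by positivity) hC0
  set H : ℝ → ℂ := fun t => A' t * E t * (Complex.I * (lam * ψ' t : ℝ))⁻¹ -
    A t * E t * (ψ'' t : ℂ) * (Complex.I * (lam * ψ' t : ℝ))⁻¹ * (ψ' t : ℂ)⁻¹ with hH
  have dG : ∀ t ∈ Icc (t0 + δ) β, HasDerivAt G (A t * E t + H t) t := by
    intro t ht
    have hne : ψ' t ≠ 0 := abs_pos.1 (posψ t ht)
    have hneC : (ψ' t : ℂ) ≠ 0 := by exact_mod_cast hne
    have hlC : (lam : ℂ) ≠ 0 := by exact_mod_cast hlam.ne'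
    have h1 : HasDerivAt (fun t => Complex.I * ((lam * ψ' t : ℝ) : ℂ))
        (Complex.I * ((lam * ψ'' t : ℝ) : ℂ)) t :=
      (((hψ' t).const_mul lam).ofReal_comp).const_mul _
    have h2 : Complex.I * ((lam * ψ' t : ℝ) : ℂ) ≠ 0 := by
      push_cast
      exact mul_ne_zero Complex.I_ne_zero (mul_ne_zero hlC hneC)
    have h3 := ((hA t).mul (dE t)).mul (h1.inv h2)
    refine h3.congr_deriv ?_
    simp only [hH, Pi.mul_apply, Pi.inv_apply]
    have hI := Complex.I_ne_zero
    push_cast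
    field_simp
    ring
  have nH : ∀ t ∈ Icc (t0 + δ) β, ‖H t‖ ≤ D / (lam * m) * (1 / (t - t0)) +
      C0 * M / (lam * m ^ 2) * (1 / (t - t0) ^ 2) := by
    intro t ht
    have hu := upos t ht
    have hp := posψ t ht
    have h1 : (lam * |ψ' t|)⁻¹ ≤ (lam * (m * (t - t0)))⁻¹ :=
      inv_anti₀ (by positivity) (mul_le_mul_of_nonneg_left (lowψ t ht) hlam.le)
    have h2 : |ψ' t|⁻¹ ≤ (m * (t - t0))⁻¹ := inv_anti₀ (by positivity) (lowψ t ht)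
    simp only [hH]
    refine (norm_sub_le _ _).trans ?_
    simp only [norm_mul, nE, nI]
    rw [norm_inv, Complex.norm_real, Complex.norm_real, Real.norm_eq_abs, Real.norm_eq_abs]
    have e1 : D / (lam * m) * (1 / (t - t0)) = D * 1 * (lam * (m * (t - t0)))⁻¹ := by
      field_simp
    have e2 : C0 * M / (lam * m ^ 2) * (1 / (t - t0) ^ 2) =
      C0 * 1 * M * (lam * (m * (t - t0)))⁻¹ * (m * (t - t0))⁻¹ := by
      field_simp
    rw [e1, e2]
    have := bA t ht
    have := bA' t ht
    have := bψ'' t ht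
    gcongr
  set F : ℝ → ℂ := fun t => (∫ x in (t0 + δ)..t, A x * E x) - G t with hF
  have dF : ∀ t ∈ Icc (t0 + δ) β, HasDerivAt F (- H t) t := by
    intro t ht
    have h1 := (intervalIntegral.integral_hasDerivAt_right (cAE.intervalIntegrable (t0 + δ) t)
      (cAE.stronglyMeasurableAtFilter _ _) cAE.continuousAt).sub (dG t ht)
    refine h1.congr_deriv ?_
    ring
  set B : ℝ → ℝ := fun t => D / (lam * m) * (log (t - t0) - log δ) +
    C0 * M / (lam * m ^ 2) * (1 / δ - (t - t0)⁻¹) + C0 / (lam * m * δ) with hB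
  have dB : ∀ t ∈ Icc (t0 + δ) β, HasDerivAt B (D / (lam * m) * (1 / (t - t0)) +
      C0 * M / (lam * m ^ 2) * (1 / (t - t0) ^ 2)) t := by
    intro t ht
    have hu := upos t ht
    have h0 : HasDerivAt (fun t => t - t0) 1 t := (hasDerivAt_id t).sub_const t0
    have h1 := ((h0.log hu.ne').sub_const (log δ)).const_mul (D / (lam * m))
    have h2 := ((h0.inv hu.ne').const_sub (1 / δ)).const_mul (C0 * M / (lam * m ^ 2))
    refine ((h1.add h2).add_const (C0 / (lam * m * δ))).congr_deriv ?_
    ring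
  have key := image_norm_le_of_norm_deriv_right_le_deriv_boundary' (f := F) (f' := fun t => - H t)
    (a := t0 + δ) (b := β) (fun t ht => (dF t ht).continuousAt.continuousWithinAt)
    (fun t ht => (dF t (Ico_subset_Icc_self ht)).hasDerivWithinAt) (B := B)
    (B' := fun t => D / (lam * m) * (1 / (t - t0)) + C0 * M / (lam * m ^ 2) * (1 / (t - t0) ^ 2))
    (by
      have := nG (t0 + δ) ⟨le_rfl, hβ⟩
      simpa [hF, hB] using this)
    (fun t ht => (dB t ht).continuousAt.continuousWithinAt)
    (fun t ht => (dB t (Ico_subset_Icc_self ht)).hasDerivWithinAt)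
    (fun t ht => by
      rw [norm_neg]
      exact nH t (Ico_subset_Icc_self ht))
  have hβm : β ∈ Icc (t0 + δ) β := ⟨hβ, le_rfl⟩
  have k1 := key hβm
  have k2 := nG β hβm
  have e : (∫ t in (t0 + δ)..β, A t * E t) = F β + G β := by simp [hF]
  rw [e]
  refine (norm_add_le _ _).trans ?_
  have hu := upos β hβm
  have b1 : D / (lam * m) * (log (β - t0) - log δ) ≤ D / (lam * m) * (-log δ) :=
    mul_le_mul_of_nonneg_left (by linarith [Real.log_nonpos hu.le hβ1]) (by positivity)
  have b2 : C0 * M / (lam * m ^ 2) * (1 / δ - (β - t0)⁻¹) ≤ C0 * M / (lam * m ^ 2) * (1 / δ) :=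
    mul_le_mul_of_nonneg_left (by linarith [inv_pos.2 hu]) (by positivity)
  simp only [hB] at k1
  linarith

lemma osc_left (A A' : ℝ → ℂ) (ψ ψ' ψ'' : ℝ → ℝ) (lam m M D C0 t0 δ α : ℝ)
    (hlam : 0 < lam) (hm : 0 < m) (hδ : 0 < δ) (hα : α ≤ t0 - δ) (hα1 : t0 - α ≤ 1)
    (hM : 0 ≤ M) (hD : 0 ≤ D) (hC0 : 0 ≤ C0)
    (hA : ∀ t, HasDerivAt A (A' t) t) (hψ : ∀ t, HasDerivAt ψ (ψ' t) t)
    (hψ' : ∀ t, HasDerivAt ψ' (ψ'' t) t)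
    (bA : ∀ t ∈ Icc α (t0 - δ), ‖A t‖ ≤ C0) (bA' : ∀ t ∈ Icc α (t0 - δ), ‖A' t‖ ≤ D)
    (bψ'' : ∀ t ∈ Icc α (t0 - δ), |ψ'' t| ≤ M)
    (bψ' : ∀ t ∈ Icc α (t0 - δ), m * |t - t0| ≤ |ψ' t|) :
    ‖∫ t in α..(t0 - δ), A t * Complex.exp (Complex.I * ((lam * ψ t : ℝ) : ℂ))‖ ≤
      2 * (C0 / (lam * m * δ)) + D / (lam * m) * (-log δ) + C0 * M / (lam * m ^ 2) * (1 / δ) := by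
  have mem : ∀ t ∈ Icc (-t0 + δ) (-α), -t ∈ Icc α (t0 - δ) := fun t ht =>
    ⟨by linarith [ht.2], by linarith [ht.1]⟩
  have h := osc_right (fun t => A (-t)) (fun t => - A' (-t)) (fun t => ψ (-t)) (fun t => - ψ' (-t))
    (fun t => ψ'' (-t)) lam m M D C0 (-t0) δ (-α) hlam hm hδ (by linarith) (by linarith) hM hD hC0
    (fun t => by simpa [Function.comp_def] using (hA (-t)).scomp t (hasDerivAt_neg t))
    (fun t => by simpa [Function.comp_def] using (hψ (-t)).scomp t (hasDerivAt_neg t))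
    (fun t => by
      have h := ((hψ' (-t)).scomp t (hasDerivAt_neg t)).fun_neg
      simpa [Function.comp_def] using h)
    (fun t ht => bA _ (mem t ht)) (fun t ht => by simpa using bA' _ (mem t ht))
    (fun t ht => bψ'' _ (mem t ht))
    (fun t ht => by
      have := bψ' _ (mem t ht)
      rw [abs_neg]
      rwa [show -t - t0 = -(t - -t0) by ring, abs_neg] at this)
  rw [intervalIntegral.integral_comp_neg
    (fun t => A t * Complex.exp (Complex.I * ((lam * ψ t : ℝ) : ℂ)))] at h
  simpa [neg_add_eq_sub, sub_eq_add_neg, add_comm] using h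

lemma osc_min (ψ' ψ'' : ℝ → ℝ) (m α β : ℝ) (hαβ : α ≤ β)
    (hψ' : ∀ t, HasDerivAt ψ' (ψ'' t) t) (bψ'' : ∀ t ∈ Icc α β, m ≤ |ψ'' t|) :
    ∃ t0 ∈ Icc α β, ∀ t ∈ Icc α β, m * |t - t0| ≤ |ψ' t| := by
  have hc : Continuous ψ' := continuous_iff_continuousAt.2 fun t => (hψ' t).continuousAt
  obtain ⟨t0, ht0, hmin⟩ := isCompact_Icc.exists_isMinOn (nonempty_Icc.2 hαβ)
    (continuous_abs.comp hc).continuousOn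
  refine ⟨t0, ht0, fun t ht => ?_⟩
  have hmin' : ∀ x ∈ Icc α β, |ψ' t0| ≤ |ψ' x| := fun x hx => hmin hx
  have hd : m * |t - t0| ≤ |ψ' t - ψ' t0| := by
    have gen : ∀ x ∈ Icc α β, ∀ y ∈ Icc α β, x < y → m * |y - x| ≤ |ψ' y - ψ' x| := by
      intro x hx y hy hxy
      obtain ⟨c, hc1, hc2⟩ := exists_hasDerivAt_eq_slope ψ' ψ'' hxy hc.continuousOn
        (fun z _ => hψ' z)
      have hyx : 0 < y - x := by linarith
      have : ψ' y - ψ' x = ψ'' c * (y - x) := by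
        rw [hc2]
        field_simp
      rw [this, abs_mul]
      exact mul_le_mul_of_nonneg_right
        (bψ'' c ⟨by linarith [hx.1, hc1.1], by linarith [hy.2, hc1.2]⟩) (abs_nonneg _)
    rcases lt_trichotomy t t0 with h | h | h
    · have := gen t ht t0 ht0 h
      rwa [abs_sub_comm, abs_sub_comm (ψ' t0)] at this
    · simp [h]
    · exact gen t0 ht0 t ht h
  refine hd.trans ?_
  have h1 := hmin' t ht
  by_cases hs : 0 ≤ ψ' t * ψ' t0
  · rw [← sq_le_sq] at *
    have h2 : |ψ' t0| * |ψ' t0| ≤ |ψ' t| * |ψ' t0| := mul_le_mul_of_nonneg_right (sq_le_sq.1 h1) (abs_nonneg _)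
    rw [abs_mul_abs_self, ← abs_mul, abs_of_nonneg hs] at h2
    nlinarith
  · have h0 : (0:ℝ) ∈ uIcc (ψ' t) (ψ' t0) := by
      rw [mem_uIcc]
      push Not at hs
      rcases mul_neg_iff.1 hs with h | h
      · right; exact ⟨h.2.le, h.1.le⟩
      · left; exact ⟨h.1.le, h.2.le⟩
    obtain ⟨z, hz, hz0⟩ := intermediate_value_uIcc (hc.continuousOn (s := uIcc t t0)) h0
    have hzm : z ∈ Icc α β := ordConnected_Icc.uIcc_subset ht ht0 hz
    have := hmin' z hzm
    rw [hz0, abs_zero] at this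
    have : ψ' t0 = 0 := abs_nonpos_iff.1 this
    simp [this]

lemma osc_full (A A' : ℝ → ℂ) (ψ ψ' ψ'' : ℝ → ℝ) (lam m M D C0 δ α β : ℝ)
    (hlam : 0 < lam) (hm : 0 < m) (hδ : 0 < δ) (hδ1 : δ ≤ 1) (hαβ : α ≤ β) (hβ1 : β - α ≤ 1)
    (hM : 0 ≤ M) (hD : 0 ≤ D) (hC0 : 0 ≤ C0)
    (hA : ∀ t, HasDerivAt A (A' t) t) (hψ : ∀ t, HasDerivAt ψ (ψ' t) t)
    (hψ' : ∀ t, HasDerivAt ψ' (ψ'' t) t)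
    (bA : ∀ t ∈ Icc α β, ‖A t‖ ≤ C0) (bA' : ∀ t ∈ Icc α β, ‖A' t‖ ≤ D)
    (bψ'' : ∀ t ∈ Icc α β, |ψ'' t| ≤ M)
    (bψl : ∀ t ∈ Icc α β, m ≤ |ψ'' t|) :
    ‖∫ t in α..β, A t * Complex.exp (Complex.I * ((lam * ψ t : ℝ) : ℂ))‖ ≤
      C0 * (2 * δ) + 2 * (2 * (C0 / (lam * m * δ)) + D / (lam * m) * (-log δ) +
        C0 * M / (lam * m ^ 2) * (1 / δ)) := by
  obtain ⟨t0, ht0, hmin⟩ := osc_min ψ' ψ'' m α β hαβ hψ' bψl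
  set K := 2 * (C0 / (lam * m * δ)) + D / (lam * m) * (-log δ) +
        C0 * M / (lam * m ^ 2) * (1 / δ) with hK
  have hK0 : 0 ≤ K := by
    have : 0 ≤ -log δ := by linarith [Real.log_nonpos hδ.le hδ1]
    positivity
  set f : ℝ → ℂ := fun t => A t * Complex.exp (Complex.I * ((lam * ψ t : ℝ) : ℂ)) with hf
  have cf : Continuous f := by
    have h1 : Continuous A := continuous_iff_continuousAt.2 fun t => (hA t).continuousAt
    have h2 : Continuous ψ := continuous_iff_continuousAt.2 fun t => (hψ t).continuousAt
    simp only [hf]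
    fun_prop
  have nf : ∀ t ∈ Icc α β, ‖f t‖ ≤ C0 := by
    intro t ht
    simp only [hf]
    rw [norm_mul, mul_comm Complex.I, Complex.norm_exp_ofReal_mul_I, mul_one]
    exact bA t ht
  set p := max α (t0 - δ) with hp
  set q := min β (t0 + δ) with hq
  have p1 : α ≤ p := le_max_left _ _
  have p2 : p ≤ t0 := max_le ht0.1 (by linarith)
  have p3 : t0 - δ ≤ p := le_max_right _ _
  have q1 : q ≤ β := min_le_left _ _
  have q2 : t0 ≤ q := le_min ht0.2 (by linarith)
  have q3 : q ≤ t0 + δ := min_le_right _ _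
  have I1 : ‖∫ t in α..p, f t‖ ≤ K := by
    rcases le_total (t0 - δ) α with h | h
    · rw [hp, max_eq_left h]
      simpa using hK0
    · rw [hp, max_eq_right h]
      have sub : Icc α (t0 - δ) ⊆ Icc α β := Icc_subset_Icc_right (by linarith [ht0.2])
      exact osc_left A A' ψ ψ' ψ'' lam m M D C0 t0 δ α hlam hm hδ h (by linarith [ht0.2]) hM hD hC0
        hA hψ hψ' (fun t ht => bA t (sub ht)) (fun t ht => bA' t (sub ht))
        (fun t ht => bψ'' t (sub ht)) (fun t ht => hmin t (sub ht))
  have I3 : ‖∫ t in q..β, f t‖ ≤ K := by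
    rcases le_total β (t0 + δ) with h | h
    · rw [hq, min_eq_left h]
      simpa using hK0
    · rw [hq, min_eq_right h]
      have sub : Icc (t0 + δ) β ⊆ Icc α β := Icc_subset_Icc_left (by linarith [ht0.1])
      exact osc_right A A' ψ ψ' ψ'' lam m M D C0 t0 δ β hlam hm hδ h (by linarith [ht0.1]) hM hD hC0
        hA hψ hψ' (fun t ht => bA t (sub ht)) (fun t ht => bA' t (sub ht))
        (fun t ht => bψ'' t (sub ht)) (fun t ht => hmin t (sub ht))
  have I2 : ‖∫ t in p..q, f t‖ ≤ C0 * (2 * δ) := by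
    have hpq : p ≤ q := p2.trans q2
    have := intervalIntegral.norm_integral_le_of_norm_le_const (a := p) (b := q) (f := f) (C := C0)
      (fun t ht => by
        rw [uIoc_of_le hpq] at ht
        exact nf t ⟨by linarith [ht.1], by linarith [ht.2]⟩)
    refine this.trans (mul_le_mul_of_nonneg_left ?_ hC0)
    rw [abs_of_nonneg (by linarith)]
    linarith
  have e1 := intervalIntegral.integral_add_adjacent_intervals
    (cf.intervalIntegrable (μ := volume) α p) (cf.intervalIntegrable p q)
  have e2 := intervalIntegral.integral_add_adjacent_intervals
    (cf.intervalIntegrable (μ := volume) α q) (cf.intervalIntegrable q β)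
  rw [← e2, ← e1]
  have := norm_add₃_le (a := ∫ t in α..p, f t) (b := ∫ t in p..q, f t) (c := ∫ t in q..β, f t)
  linarith

/-- Stationary-phase bound on a small square: if `a` is supported in an axis-parallel
closed square `Q ⊆ (-1/2,1/2)²` of side `≤ 8λ^{-ε₀}`, with `|∂_t^j a| ≤ C_j λ^{j/2}`,
`|∂_t^j ∂_t φ| ≤ λ^{ε₀/8}` for `j ≤ N = ⌈16/ε₀⌉`, and `|∂_t² φ| ≥ λ^{-ε₀/8}` on `Q`, then
`λ^{1/2} |∬ a e^{iλφ}| ≤ C λ^{-ε₀/2}`. -/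
theorem stationary_phase_small_square
    (ε₀ : ℝ) (hε₀0 : 0 < ε₀) (hε₀1 : ε₀ < 1 / 10)
    (Cc : ℕ → ℝ) (hCc : ∀ j ≤ ⌈(16 : ℝ) / ε₀⌉₊, 0 ≤ Cc j) :
    ∃ C > (0 : ℝ), ∀ (lam : ℝ), 2 ≤ lam →
      ∀ (φ : ℝ × ℝ → ℝ), ContDiff ℝ (⊤ : ℕ∞) φ →
      ∀ (a : ℝ × ℝ → ℂ), ContDiff ℝ (⊤ : ℕ∞) a →
      ∀ (t₁ s₁ L : ℝ), 0 ≤ L → L ≤ 8 * lam ^ (-ε₀) →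
        Icc t₁ (t₁ + L) ×ˢ Icc s₁ (s₁ + L) ⊆
          Ioo (-(1 / 2) : ℝ) (1 / 2) ×ˢ Ioo (-(1 / 2) : ℝ) (1 / 2) →
        tsupport a ⊆ Icc t₁ (t₁ + L) ×ˢ Icc s₁ (s₁ + L) →
      (∀ p ∈ Icc t₁ (t₁ + L) ×ˢ Icc s₁ (s₁ + L), ∀ j ≤ ⌈(16 : ℝ) / ε₀⌉₊,
        ‖pderiv2 (j, 0) a p‖ ≤ Cc j * lam ^ ((j : ℝ) / 2)) →
      (∀ p ∈ Icc t₁ (t₁ + L) ×ˢ Icc s₁ (s₁ + L), ∀ j ≤ ⌈(16 : ℝ) / ε₀⌉₊,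
        |pderiv2 (j + 1, 0) φ p| ≤ lam ^ (ε₀ / 8)) →
      (∀ p ∈ Icc t₁ (t₁ + L) ×ˢ Icc s₁ (s₁ + L),
        lam ^ (-ε₀ / 8) ≤ |pderiv2 (2, 0) φ p|) →
      lam ^ ((1 : ℝ) / 2) *
        ‖∫ p : ℝ × ℝ, a p * Complex.exp (Complex.I * ((lam * φ p : ℝ) : ℂ))‖ ≤
        C * lam ^ (-ε₀ / 2) := by
  have hN : 1 ≤ ⌈(16 : ℝ) / ε₀⌉₊ := Nat.one_le_ceil_iff.2 (by positivity)
  have hC0 := hCc 0 (by omega)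
  have hC1 := hCc 1 hN
  set K := 8 * Cc 0 + 4 * Cc 1 / ε₀ with hKdef
  have hK : 0 ≤ K := by positivity
  refine ⟨8 * K + 1, by positivity, ?_⟩
  intro lam hlam φ hφ a ha t₁ s₁ L hL0 hL hQ hsupp ba bφ bφ2
  have hl0 : 0 < lam := by linarith
  have hl1 : 1 ≤ lam := by linarith
  have hL1 : L ≤ 1 := by
    have h1 := hQ (show (t₁, s₁) ∈ _ from ⟨⟨le_rfl, by linarith⟩, ⟨le_rfl, by linarith⟩⟩)
    have h2 := hQ (show (t₁ + L, s₁) ∈ _ from ⟨⟨by linarith, le_rfl⟩, ⟨le_rfl, by linarith⟩⟩)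
    have h3 := h1.1.1
    have h4 := h2.1.2
    simp only at h3 h4
    linarith
  set f : ℝ × ℝ → ℂ := fun p => a p * Complex.exp (Complex.I * ((lam * φ p : ℝ) : ℂ)) with hf
  have fzero : ∀ p, p ∉ Icc t₁ (t₁ + L) ×ˢ Icc s₁ (s₁ + L) → f p = 0 := by
    intro p hp
    have : a p = 0 := image_eq_zero_of_notMem_tsupport fun h => hp (hsupp h)
    simp [hf, this]
  have cf : Continuous f := by
    have h1 := ha.continuous
    have h2 := hφ.continuous
    simp only [hf]
    fun_prop
  have intf : Integrable f := by
    refine cf.integrable_of_hasCompactSupport ?_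
    exact HasCompactSupport.intro (isCompact_Icc.prod isCompact_Icc) fzero
  set P := lam ^ (-(1 / 2 : ℝ) + 3 * ε₀ / 8) with hP
  have inner : ∀ s ∈ Icc s₁ (s₁ + L), ‖∫ t, f (t, s)‖ ≤ K * P := by
    intro s hs
    have e : ∫ t, f (t, s) = ∫ t in t₁..(t₁ + L), f (t, s) := by
      rw [intervalIntegral.integral_of_le (by linarith), ← integral_Icc_eq_integral_Ioc]
      exact (setIntegral_eq_integral_of_forall_compl_eq_zero
        (fun t ht => fzero _ fun h => ht h.1)).symm
    rw [e]
    have cA : ContDiff ℝ (⊤ : ℕ∞) (fun t => a (t, s)) := by fun_prop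
    have cψ : ContDiff ℝ (⊤ : ℕ∞) (fun t => φ (t, s)) := by fun_prop
    have dA := cA.differentiable (by simp)
    have dψ := cψ.differentiable (by simp)
    have cψ' : ContDiff ℝ (⊤ : ℕ∞) (deriv (fun t => φ (t, s))) :=
      (contDiff_infty_iff_deriv.1 cψ).2
    have dψ' := cψ'.differentiable (by simp)
    have hmem : ∀ t ∈ Icc t₁ (t₁ + L), (t, s) ∈ Icc t₁ (t₁ + L) ×ˢ Icc s₁ (s₁ + L) :=
      fun t ht => ⟨ht, hs⟩
    have e2 : ∀ t, pderiv2 (2, 0) φ (t, s) = deriv (deriv (fun t => φ (t, s))) t := by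
      intro t
      simp only [pderiv2, iteratedDeriv_zero]
      rw [show (2:ℕ) = 1 + 1 from rfl, iteratedDeriv_succ, iteratedDeriv_one]
    have main := osc_full (fun t => a (t, s)) (deriv fun t => a (t, s)) (fun t => φ (t, s))
      (deriv fun t => φ (t, s)) (deriv (deriv fun t => φ (t, s))) lam (lam ^ (-ε₀ / 8))
      (lam ^ (ε₀ / 8)) (Cc 1 * lam ^ (1 / 2 : ℝ)) (Cc 0) (lam ^ (-(1 / 2) : ℝ)) t₁ (t₁ + L)
      hl0 (by positivity) (by positivity)
      (Real.rpow_le_one_of_one_le_of_nonpos hl1 (by norm_num)) (by linarith) (by linarith)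
      (by positivity) (by positivity) hC0
      (fun t => (dA t).hasDerivAt) (fun t => (dψ t).hasDerivAt) (fun t => (dψ' t).hasDerivAt)
      (fun t ht => by simpa [pderiv2] using ba _ (hmem t ht) 0 (by omega))
      (fun t ht => by simpa [pderiv2, iteratedDeriv_one] using ba _ (hmem t ht) 1 hN)
      (fun t ht => by
        have := bφ _ (hmem t ht) 1 hN
        rwa [show 1 + 1 = 2 from rfl, e2] at this)
      (fun t ht => by
        have := bφ2 _ (hmem t ht)
        rwa [e2] at this)
    refine main.trans ?_
    have x1 : lam ^ (-(1 / 2) : ℝ) ≤ P := Real.rpow_le_rpow_of_exponent_le hl1 (by linarith)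
    have x2 : (lam * lam ^ (-ε₀ / 8) * lam ^ (-(1 / 2) : ℝ))⁻¹ ≤ P := by
      nth_rewrite 1 [← Real.rpow_one lam]
      rw [← Real.rpow_add hl0, ← Real.rpow_add hl0, ← Real.rpow_neg hl0.le]
      exact Real.rpow_le_rpow_of_exponent_le hl1 (by linarith)
    have x3 : lam ^ (1 / 2 : ℝ) * (lam * lam ^ (-ε₀ / 8))⁻¹ * lam ^ (ε₀ / 4) ≤ P := by
      nth_rewrite 2 [← Real.rpow_one lam]
      rw [← Real.rpow_add hl0, ← Real.rpow_neg hl0.le, ← Real.rpow_add hl0, ← Real.rpow_add hl0]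
      exact Real.rpow_le_rpow_of_exponent_le hl1 (by linarith)
    have x4 : lam ^ (ε₀ / 8) * (lam * (lam ^ (-ε₀ / 8)) ^ 2)⁻¹ * (lam ^ (-(1 / 2) : ℝ))⁻¹ ≤ P := by
      nth_rewrite 2 [← Real.rpow_one lam]
      rw [pow_two, ← Real.rpow_add hl0, ← Real.rpow_add hl0, ← Real.rpow_neg hl0.le,
        ← Real.rpow_neg hl0.le, ← Real.rpow_add hl0, ← Real.rpow_add hl0]
      exact Real.rpow_le_rpow_of_exponent_le hl1 (by linarith)
    have x5 : -log (lam ^ (-(1 / 2) : ℝ)) ≤ 2 / ε₀ * lam ^ (ε₀ / 4) := by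
      rw [Real.log_rpow hl0]
      have := Real.log_le_rpow_div hl0.le (show 0 < ε₀ / 4 by positivity)
      have e : 2 / ε₀ * lam ^ (ε₀ / 4) = 1 / 2 * (lam ^ (ε₀ / 4) / (ε₀ / 4)) := by
        field_simp
        norm_num
      rw [e]
      linarith
    have y1 := mul_le_mul_of_nonneg_left x1 hC0
    have y2 := mul_le_mul_of_nonneg_left x2 hC0
    have y4 := mul_le_mul_of_nonneg_left x4 hC0
    have y3 : Cc 1 * lam ^ (1 / 2 : ℝ) / (lam * lam ^ (-ε₀ / 8)) * (-log (lam ^ (-(1 / 2) : ℝ))) ≤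
        Cc 1 * (2 / ε₀) * P := by
      refine (mul_le_mul_of_nonneg_left x5 (by positivity)).trans ?_
      refine le_trans (le_of_eq ?_)
        (mul_le_mul_of_nonneg_left x3 (show 0 ≤ Cc 1 * (2 / ε₀) by positivity))
      rw [div_eq_mul_inv]
      ring
    have z2 : Cc 0 / (lam * lam ^ (-ε₀ / 8) * lam ^ (-(1 / 2) : ℝ)) ≤ Cc 0 * P := y2
    have z4 : Cc 0 * lam ^ (ε₀ / 8) / (lam * (lam ^ (-ε₀ / 8)) ^ 2) *
        (1 / lam ^ (-(1 / 2) : ℝ)) ≤ Cc 0 * P := by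
      refine le_trans (le_of_eq ?_) y4
      rw [div_eq_mul_inv, one_div]
      ring
    have eK : K * P = Cc 0 * P * 8 + 2 * (Cc 1 * (2 / ε₀) * P) := by
      rw [hKdef]
      ring
    rw [eK]
    linarith
  have tot : ‖∫ p, f p‖ ≤ K * P * L := by
    rw [Measure.volume_eq_prod, integral_prod_symm _ (by rwa [← Measure.volume_eq_prod])]
    have e : ∫ s, ∫ t, f (t, s) = ∫ s in Icc s₁ (s₁ + L), ∫ t, f (t, s) := by
      refine (setIntegral_eq_integral_of_forall_compl_eq_zero fun s hs => ?_).symm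
      rw [integral_eq_zero_of_ae]
      exact Filter.Eventually.of_forall fun t => fzero _ fun h => hs h.2
    rw [e]
    have := norm_setIntegral_le_of_norm_le_const (μ := volume) (s := Icc s₁ (s₁ + L))
      (f := fun s => ∫ t, f (t, s)) (by simp) inner
    simpa [hL0] using this
  have hP0 : 0 < P := by positivity
  calc lam ^ ((1 : ℝ) / 2) * ‖∫ p, f p‖ ≤ lam ^ ((1 : ℝ) / 2) * (K * P * (8 * lam ^ (-ε₀))) := by
        refine mul_le_mul_of_nonneg_left (tot.trans ?_) (by positivity)
        exact mul_le_mul_of_nonneg_left hL (by positivity)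
    _ = 8 * K * (lam ^ ((1 : ℝ) / 2) * P * lam ^ (-ε₀)) := by ring
    _ ≤ 8 * K * lam ^ (-ε₀ / 2) := by
        refine mul_le_mul_of_nonneg_left ?_ (by positivity)
        rw [hP, ← Real.rpow_add hl0, ← Real.rpow_add hl0]
        exact Real.rpow_le_rpow_of_exponent_le hl1 (by linarith)
    _ ≤ (8 * K + 1) * lam ^ (-ε₀ / 2) := by
        refine mul_le_mul_of_nonneg_right (by linarith) (by positivity)
end
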